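/- (CALM calibration guarantee, general bounded-loss form.) Let (𝒫, 𝒜) be a measurable space with probability measure μ, let k ≥ 1 and n ≥ 1, let δ, ε ∈ (0,1), and let L_1, …, L_k : 𝒫 → [0,1] be measurable loss functions with risks R_j := ∫ L_j dμ; additionally set R_0 := 0 (the loss of the fallback threshold λ = 1 is identically zero). Model the i.i.d. calibration sample of size n on the product space Ω := 𝒫^n with ℙ := μ^{⊗n}. For ω = (ω_1, …, ω_n) ∈ Ω define the empirical risks Ê_j(ω) := (1/n) ∑_{i=1}^n L_j(ω_i) and the Hoeffding p-values p_j(ω) := exp(−2n · (max(0, δ − Ê_j(ω)))²) for j = 1, …, k. Let J(ω) be the largest index j ∈ {0, 1, …, k} such that p_i(ω) ≤ ε for all i ≤ j (so J(ω) = 0 if p_1(ω) > ε). Then ℙ({ω : R_{J(ω)} ≤ δ}) ≥ 1 − ε. -/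

import Mathlib

open MeasureTheory

/-- The index `J(ω) ∈ {0, 1, …, k}` selected by fixed sequence testing at level `ε`
over the Hoeffding p-values `p_j(ω) := exp (−2n (max 0 (δ − Ê_j(ω)))²)`, where
`Ê_j(ω) := (1/n) ∑_{s} L j (ω s)` is the empirical risk of the `j`-th loss on the
calibration sample `ω : Fin n → P` : it is the largest `j ≤ k` such that `p_i(ω) ≤ ε`
for all `1 ≤ i ≤ j` (and `0` if `p_1(ω) > ε`). -/
noncomputable def calmIndex {P : Type*} (k n : ℕ) (δ ε : ℝ) (L : ℕ → P → ℝ)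
    (ω : Fin n → P) : ℕ :=
  sSup {j | j ≤ k ∧ ∀ i, 1 ≤ i → i ≤ j →
    Real.exp (-(2 * (n : ℝ)) *
      (max 0 (δ - (1 / (n : ℝ)) * ∑ s, L i (ω s))) ^ 2) ≤ ε}

open ProbabilityTheory in
/-- **Hoeffding's inequality**, lower tail, for the sum of a `[0,1]`-valued function over an
i.i.d. sample. -/
theorem measureReal_pi_sum_integral_sub_ge_le {P : Type*} [MeasurableSpace P] (μ : Measure P)
    [IsProbabilityMeasure μ] (n : ℕ) {f : P → ℝ} (hf : Measurable f)
    (hf01 : ∀ x, f x ∈ Set.Icc (0 : ℝ) 1) {u : ℝ} (hu : 0 ≤ u) :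
    (Measure.pi (fun _ : Fin n => μ)).real {ω | u ≤ ∑ s, ((∫ x, f x ∂μ) - f (ω s))} ≤
      Real.exp (-(2 * u ^ 2 / n)) := by
  have hsub : HasSubgaussianMGF (fun x => (∫ y, f y ∂μ) - f x) ((‖(1 : ℝ) - 0‖₊ / 2) ^ 2) μ := by
    refine (hasSubgaussianMGF_of_mem_Icc hf.aemeasurable
      (Filter.Eventually.of_forall hf01)).neg.congr (Filter.Eventually.of_forall fun x => ?_)
    simp
  have hmeas : Measurable fun x => (∫ y, f y ∂μ) - f x := hf.const_sub _
  have hcoord (s : Fin n) : HasSubgaussianMGF (fun ω : Fin n → P => (∫ y, f y ∂μ) - f (ω s))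
      ((‖(1 : ℝ) - 0‖₊ / 2) ^ 2) (Measure.pi fun _ : Fin n => μ) := by
    have hev := measurePreserving_eval (fun _ : Fin n => μ) s
    exact HasSubgaussianMGF.of_map (Y := Function.eval s) (X := fun x => (∫ y, f y ∂μ) - f x)
      hev.measurable.aemeasurable (by rwa [hev.map_eq])
  refine (HasSubgaussianMGF.measure_sum_ge_le_of_iIndepFun
    (iIndepFun_pi (fun _ => hmeas.aemeasurable)) (fun s _ => hcoord s) hu).trans_eq ?_
  congr 1
  simp
  rcases eq_or_ne (n : ℝ) 0 with h | h
  · simp [h]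
  · field_simp

/-- The Hoeffding p-value of the null hypothesis `δ ≤ ∫ f dμ` is super-uniform. -/
theorem measure_pi_hoeffding_pvalue_le {P : Type*} [MeasurableSpace P] (μ : Measure P)
    [IsProbabilityMeasure μ] {n : ℕ} (hn : 1 ≤ n) {f : P → ℝ} (hf : Measurable f)
    (hf01 : ∀ x, f x ∈ Set.Icc (0 : ℝ) 1) {δ ε : ℝ} (hδ : δ ≤ ∫ x, f x ∂μ)
    (hε : ε ∈ Set.Ioo (0 : ℝ) 1) :
    (Measure.pi (fun _ : Fin n => μ)) {ω | Real.exp (-(2 * (n : ℝ)) *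
      (max 0 (δ - (1 / (n : ℝ)) * ∑ s, f (ω s))) ^ 2) ≤ ε} ≤ ENNReal.ofReal ε := by
  have hn' : (0 : ℝ) < n := by exact_mod_cast hn
  have hlog : 0 < -Real.log ε := neg_pos.2 (Real.log_neg hε.1 hε.2)
  set t := √(-Real.log ε / (2 * n))
  have htpos : 0 < t := Real.sqrt_pos.2 (by positivity)
  have htsq : t ^ 2 = -Real.log ε / (2 * n) := Real.sq_sqrt (by positivity)
  have hsubset : {ω : Fin n → P | Real.exp (-(2 * (n : ℝ)) *
      (max 0 (δ - (1 / (n : ℝ)) * ∑ s, f (ω s))) ^ 2) ≤ ε} ⊆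
      {ω | n * t ≤ ∑ s, ((∫ x, f x ∂μ) - f (ω s))} := by
    intro ω hω
    simp only [Set.mem_ofPred_eq] at hω ⊢
    rw [← Real.le_log_iff_exp_le hε.1] at hω
    have hsq : t ^ 2 ≤ (max 0 (δ - (1 / (n : ℝ)) * ∑ s, f (ω s))) ^ 2 := by
      rw [htsq, div_le_iff₀ (by positivity)]
      linarith
    have hmax := (sq_le_sq₀ htpos.le (le_max_left _ _)).1 hsq
    have hle : t ≤ δ - (1 / (n : ℝ)) * ∑ s, f (ω s) :=
      (le_max_iff.1 hmax).resolve_left htpos.not_ge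
    have hmul := mul_le_mul_of_nonneg_left (hle.trans (sub_le_sub_right hδ _)) hn'.le
    have hcancel : (n : ℝ) * (1 / n * ∑ s, f (ω s)) = ∑ s, f (ω s) := by field_simp
    rw [mul_sub, hcancel] at hmul
    simpa using hmul
  refine (measure_mono hsubset).trans ?_
  rw [← ofReal_measureReal]
  refine ENNReal.ofReal_le_ofReal
    ((measureReal_pi_sum_integral_sub_ge_le μ n hf hf01 (by positivity)).trans_eq ?_)
  rw [mul_pow, htsq, ← Real.exp_log hε.1, Real.log_exp]
  congr 1
  field_simp

/-- The selected index is at most `k`, and all hypotheses up to it are rejected. -/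
theorem calmIndex_spec {P : Type*} (k n : ℕ) (δ ε : ℝ) (L : ℕ → P → ℝ) (ω : Fin n → P) :
    calmIndex k n δ ε L ω ≤ k ∧ ∀ i, 1 ≤ i → i ≤ calmIndex k n δ ε L ω →
      Real.exp (-(2 * (n : ℝ)) *
        (max 0 (δ - (1 / (n : ℝ)) * ∑ s, L i (ω s))) ^ 2) ≤ ε :=
  Nat.sSup_mem (s := {j | j ≤ k ∧ ∀ i, 1 ≤ i → i ≤ j →
    Real.exp (-(2 * (n : ℝ)) *
      (max 0 (δ - (1 / (n : ℝ)) * ∑ s, L i (ω s))) ^ 2) ≤ ε})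
    ⟨0, Nat.zero_le k, fun _ h1 h0 => absurd (h1.trans h0) (by norm_num)⟩ ⟨k, fun _ hj => hj.1⟩

/-- (CALM calibration guarantee, general bounded-loss form.) Let `L 1, …, L k : P → [0,1]`
be measurable losses with risks `R_j := ∫ L j dμ`, and let the fallback index `0` have
identically zero loss. Drawing an i.i.d. calibration sample of size `n` from `μ` and
selecting the index `J` by fixed sequence testing at level `ε` on the Hoeffding p-values
for tolerance `δ`, the selected risk satisfies `R_J ≤ δ` with probability at least
`1 − ε`. -/
theorem calm_calibration_guarantee
    {P : Type*} [MeasurableSpace P] (μ : Measure P) [IsProbabilityMeasure μ]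
    (k n : ℕ) (hk : 1 ≤ k) (hn : 1 ≤ n)
    (δ ε : ℝ) (hδ : δ ∈ Set.Ioo (0 : ℝ) 1) (hε : ε ∈ Set.Ioo (0 : ℝ) 1)
    (L : ℕ → P → ℝ)
    (hLmeas : ∀ j ∈ Finset.Icc 1 k, Measurable (L j))
    (hL01 : ∀ j ∈ Finset.Icc 1 k, ∀ x, L j x ∈ Set.Icc (0 : ℝ) 1)
    (hL0 : ∀ x, L 0 x = 0) :
    (Measure.pi (fun _ : Fin n => μ))
      {ω | (∫ x, L (calmIndex k n δ ε L ω) x ∂μ) ≤ δ} ≥ 1 - ENNReal.ofReal ε := by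
  set ℙ := Measure.pi (fun _ : Fin n => μ)
  set S := {ω : Fin n → P | (∫ x, L (calmIndex k n δ ε L ω) x ∂μ) ≤ δ}
  suffices hbad : ℙ Sᶜ ≤ ENNReal.ofReal ε by
    rw [ge_iff_le, tsub_le_iff_right]
    calc (1 : ENNReal) = ℙ Set.univ := measure_univ.symm
      _ ≤ ℙ S + ℙ Sᶜ := measure_univ_le_add_compl S
      _ ≤ ℙ S + ENNReal.ofReal ε := by gcongr
  have hidx : ∀ ω ∈ Sᶜ, 1 ≤ calmIndex k n δ ε L ω := by
    intro ω hω
    by_contra h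
    refine hω ?_
    have h0 : calmIndex k n δ ε L ω = 0 := by omega
    simp [S, h0, hL0, hδ.1.le]
  classical
  by_cases hex : ∃ j, 1 ≤ j ∧ j ≤ k ∧ δ < ∫ x, L j x ∂μ
  · obtain ⟨h1, hk', hrisk⟩ := Nat.find_spec hex
    have hmem := Finset.mem_Icc.2 ⟨h1, hk'⟩
    refine (measure_mono fun ω hω => ?_).trans
      (measure_pi_hoeffding_pvalue_le μ hn (hLmeas _ hmem) (hL01 _ hmem) hrisk.le hε)
    have hspec := calmIndex_spec k n δ ε L ω
    exact hspec.2 _ h1 (Nat.find_min' hex ⟨hidx ω hω, hspec.1, not_le.1 hω⟩)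
  · have hempty : Sᶜ = ∅ := Set.eq_empty_of_forall_notMem fun ω hω =>
      hex ⟨_, hidx ω hω, (calmIndex_spec k n δ ε L ω).1, not_le.1 hω⟩
    simp [hempty]
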